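/- Let H be a linear Heyting algebra. Then the underlying order of H is densely ordered if and only if the Takeuti–Titani density rule is valid in H, i.e., for all g, p, q, c ∈ H: if g ≤ (p ⇨ r) ⊔ (r ⇨ q) ⊔ c for every r ∈ H, then g ≤ (p ⇨ q) ⊔ c. -/

import Mathlib

/-- In a linear lattice every element is sup-prime. -/
theorem le_sup_iff_of_forall_le_or_le {α : Type*} [Lattice α]
    (htot : ∀ a b : α, a ≤ b ∨ b ≤ a) {a b c : α} : a ≤ b ⊔ c ↔ a ≤ b ∨ a ≤ c := by
  refine ⟨fun h => ?_, fun h => h.elim le_sup_of_le_left le_sup_of_le_right⟩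
  rcases htot b c with hbc | hcb
  · exact .inr (sup_eq_right.2 hbc ▸ h)
  · exact .inl (sup_eq_left.2 hcb ▸ h)

/-- In a linear Heyting algebra, `b ⇨ a` is bounded by `a` whenever `a < b`. -/
theorem himp_le_of_lt_of_forall_le_or_le {α : Type*} [GeneralizedHeytingAlgebra α]
    (htot : ∀ a b : α, a ≤ b ∨ b ≤ a) {a b : α} (hab : a < b) : b ⇨ a ≤ a := by
  rcases htot (b ⇨ a) b with h | h
  · simpa [inf_eq_left.2 h] using himp_inf_le (a := b) (b := a)
  · exact absurd (le_himp_iff_left.1 h) hab.not_ge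

/-- a linear Heyting algebra is densely ordered if and only if the
Takeuti–Titani density rule is valid in it. -/
theorem denselyOrdered_iff_density_rule {H : Type*} [HeytingAlgebra H]
    (htot : ∀ a b : H, a ≤ b ∨ b ≤ a) :
    DenselyOrdered H ↔
      ∀ g p q c : H, (∀ r : H, g ≤ (p ⇨ r) ⊔ (r ⇨ q) ⊔ c) → g ≤ (p ⇨ q) ⊔ c := by
  have lt_of_not_ge : ∀ {a b : H}, ¬ b ≤ a → a < b := fun {a b} h =>
    lt_of_le_not_ge ((htot a b).resolve_right h) h
  constructor
  · intro _ g p q c h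
    by_contra hg
    rw [le_sup_iff_of_forall_le_or_le htot, not_or] at hg
    obtain ⟨hgpq, hgc⟩ := hg
    have hqp : q < p := lt_of_not_ge fun hpq => hgpq (by simp [himp_eq_top_iff.2 hpq])
    have hqg : q < g := lt_of_not_ge fun hgq => hgpq (hgq.trans le_himp)
    have hq : q < p ⊓ g := by
      rcases htot p g with hpg | hgp
      · rwa [inf_eq_left.2 hpg]
      · rwa [inf_eq_right.2 hgp]
    obtain ⟨r, hqr, hr⟩ := exists_between hq
    have hgr := h r
    rw [le_sup_iff_of_forall_le_or_le htot, le_sup_iff_of_forall_le_or_le htot] at hgr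
    rcases hgr with (hgr | hgr) | hgr
    · exact (hr.trans_le inf_le_right).not_ge
        (hgr.trans (himp_le_of_lt_of_forall_le_or_le htot (hr.trans_le inf_le_left)))
    · exact hqg.not_ge (hgr.trans (himp_le_of_lt_of_forall_le_or_le htot hqr))
    · exact hgc hgr
  · refine fun h => ⟨fun a b hab => ?_⟩
    by_contra! hgap
    have hba : b ≤ (b ⇨ a) ⊔ ⊥ := h b b a ⊥ fun r => by
      by_cases hra : r ≤ a
      · simp [himp_eq_top_iff.2 hra]
      · have hbr : b ≤ r := by
          by_contra hbr
          exact hgap r (lt_of_not_ge hra) (lt_of_not_ge hbr)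
        simp [himp_eq_top_iff.2 hbr]
    rw [sup_bot_eq, le_himp_iff_left] at hba
    exact hab.not_ge hba
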